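/- arXiv:1409.5383 — 6 statements merged into one kernel-verified Lean document; each statement's English description precedes it below -/
import Mathlib

section
/- If α ≤ n−1, then the profile S = V minimizes the social cost of the SUM-game, i.e., c(V) ≤ c(S') for every nonempty S' ⊆ V. -/
open Finset

/-- Distance from a node `u` to the gateway set `S` (hop distance to nearest gateway). -/
noncomputable def gwDist {V : Type*} (G : SimpleGraph V) (S : Finset V) (u : V) : ℕ :=
  sInf ((fun s => G.dist u s) '' (S : Set V))

/-- Communication distance `δ_S(u,v) = min{d(u,v), d(u,S) + d(S,v)}`. -/
noncomputable def comDist {V : Type*} (G : SimpleGraph V) (S : Finset V) (u v : V) : ℕ :=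
  min (G.dist u v) (gwDist G S u + gwDist G S v)

/-- Private cost of node `v` in the SUM-game. -/
noncomputable def sumCost {V : Type*} [Fintype V] [DecidableEq V]
    (G : SimpleGraph V) (α : ℝ) (S : Finset V) (v : V) : ℝ :=
  (if v ∈ S then α else 0) + ∑ u : V, (comDist G S v u : ℝ)

/-- Social cost of the SUM-game. -/
noncomputable def sumSocial {V : Type*} [Fintype V] [DecidableEq V]
    (G : SimpleGraph V) (α : ℝ) (S : Finset V) : ℝ :=
  ∑ v : V, sumCost G α S v

/-- `v` performs an improving response changing profile `S` into `S'` in the SUM-game. -/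
def SumIRBy {V : Type*} [Fintype V] [DecidableEq V]
    (G : SimpleGraph V) (α : ℝ) (v : V) (S S' : Finset V) : Prop :=
  ((v ∉ S ∧ S' = insert v S) ∨ (v ∈ S ∧ S' = S.erase v ∧ (S.erase v).Nonempty)) ∧
    sumCost G α S' v < sumCost G α S v

/-- `S'` arises from `S` by an improving response in the SUM-game. -/
def SumIR {V : Type*} [Fintype V] [DecidableEq V]
    (G : SimpleGraph V) (α : ℝ) (S S' : Finset V) : Prop :=
  ∃ v, SumIRBy G α v S S'

/-- `S` is a Nash equilibrium of the SUM-game: no node has an improving response. -/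
def SumNash {V : Type*} [Fintype V] [DecidableEq V]
    (G : SimpleGraph V) (α : ℝ) (S : Finset V) : Prop :=
  ∀ S', ¬ SumIR G α S S'

theorem gwDist_eq_zero_of_mem {V : Type*} (G : SimpleGraph V) {S : Finset V} {v : V}
    (hv : v ∈ S) : gwDist G S v = 0 :=
  Nat.sInf_eq_zero.2 (Or.inl ⟨v, hv, SimpleGraph.dist_self⟩)

theorem gwDist_pos_of_notMem {V : Type*} {G : SimpleGraph V} (hG : G.Connected)
    {S : Finset V} (hS : S.Nonempty) {v : V} (hv : v ∉ S) : 0 < gwDist G S v := by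
  obtain ⟨s, hs, hd⟩ := Nat.sInf_mem
    (Set.Nonempty.image (fun s => G.dist v s) (Finset.coe_nonempty.2 hS))
  have hne : v ≠ s := fun hvs => hv (hvs ▸ hs)
  exact (hG.pos_dist_of_ne hne).trans_eq hd

theorem sumCost_univ {V : Type*} [Fintype V] [DecidableEq V] (G : SimpleGraph V)
    (α : ℝ) (v : V) : sumCost G α univ v = α := by
  simp [sumCost, comDist, gwDist_eq_zero_of_mem]

theorem comDist_pos_of_notMem {V : Type*} {G : SimpleGraph V} (hG : G.Connected)
    {S : Finset V} (hS : S.Nonempty) {u v : V} (hv : v ∉ S) (huv : v ≠ u) :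
    0 < comDist G S v u :=
  lt_min (hG.pos_dist_of_ne huv) (Nat.add_pos_left (gwDist_pos_of_notMem hG hS hv) _)

theorem card_sub_one_le_sum_comDist {V : Type*} [Fintype V] [DecidableEq V]
    {G : SimpleGraph V} (hG : G.Connected) {S : Finset V} (hS : S.Nonempty) {v : V}
    (hv : v ∉ S) : (Fintype.card V : ℝ) - 1 ≤ ∑ u : V, (comDist G S v u : ℝ) := by
  have hle : (univ.erase v).card ≤ ∑ u ∈ univ.erase v, comDist G S v u := by
    rw [Finset.card_eq_sum_ones]
    exact Finset.sum_le_sum fun u hu =>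
      comDist_pos_of_notMem hG hS hv (Finset.ne_of_mem_erase hu).symm
  have hsub : ∑ u ∈ univ.erase v, comDist G S v u ≤ ∑ u, comDist G S v u :=
    Finset.sum_le_sum_of_subset (Finset.erase_subset _ _)
  have hcard : (univ.erase v).card + 1 = Fintype.card V :=
    Finset.card_erase_add_one (Finset.mem_univ v)
  have hnat : Fintype.card V ≤ ∑ u, comDist G S v u + 1 := by omega
  rw [sub_le_iff_le_add]
  exact_mod_cast hnat

/-- If α ≤ n−1 then S = V minimizes the social cost of the SUM-game. -/
theorem stmt_2 {V : Type*} [Fintype V] [DecidableEq V] (G : SimpleGraph V)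
    (hG : G.Connected) (α : ℝ) (hα : 0 < α)
    (h : α ≤ (Fintype.card V : ℝ) - 1) :
    ∀ S' : Finset V, S'.Nonempty → sumSocial G α Finset.univ ≤ sumSocial G α S' := by
  intro S hS
  refine Finset.sum_le_sum fun v _ => ?_
  rw [sumCost_univ, sumCost]
  split_ifs with hv
  · exact le_add_of_nonneg_right (Finset.sum_nonneg fun u _ => Nat.cast_nonneg _)
  · rw [zero_add]
    exact h.trans (card_sub_one_le_sum_comDist hG hS hv)
end

section
/- If α < 1 or α > n·diam(G), then the SUM-game has the finite improvement property: there is no infinite sequence of profiles S_0, S_1, S_2, … in which each S_{i+1} arises from S_i by an improving response. -/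
open Finset

namespace GatewayGame

variable {V : Type*} {G : SimpleGraph V} {S T : Finset V}

lemma gwDist_le {s : V} (hs : s ∈ S) (u : V) : gwDist G S u ≤ G.dist u s :=
  Nat.sInf_le ⟨s, hs, rfl⟩

lemma exists_gwDist_eq (hS : S.Nonempty) (u : V) : ∃ s ∈ S, gwDist G S u = G.dist u s := by
  obtain ⟨s, hs, h⟩ := Nat.sInf_mem (s := (fun s => G.dist u s) '' (S : Set V))
    ((coe_nonempty.mpr hS).image _)
  exact ⟨s, hs, h.symm⟩

lemma gwDist_anti (hS : S.Nonempty) (hST : S ⊆ T) (u : V) : gwDist G T u ≤ gwDist G S u := by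
  obtain ⟨s, hs, h⟩ := exists_gwDist_eq (G := G) hS u
  exact h ▸ gwDist_le (hST hs) u

lemma comDist_anti (hS : S.Nonempty) (hST : S ⊆ T) (u v : V) :
    comDist G T u v ≤ comDist G S u v :=
  min_le_min le_rfl (add_le_add (gwDist_anti hS hST u) (gwDist_anti hS hST v))

lemma comDist_comm (u v : V) : comDist G S u v = comDist G S v u := by
  rw [comDist, comDist, G.dist_comm, add_comm]

lemma gwDist_le_dist_add (hG : G.Connected) (hS : S.Nonempty) (u v : V) :
    gwDist G S u ≤ G.dist u v + gwDist G S v := by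
  obtain ⟨s, hs, h⟩ := exists_gwDist_eq (G := G) hS v
  rw [h]
  exact (gwDist_le hs u).trans hG.dist_triangle

lemma comDist_le_dist_add (hG : G.Connected) (hS : S.Nonempty) (u v w : V) :
    comDist G S u w ≤ G.dist u v + comDist G S v w := by
  have h₁ := gwDist_le_dist_add hG hS u v
  have h₂ : G.dist u w ≤ G.dist u v + G.dist v w := hG.dist_triangle
  unfold comDist
  omega

lemma comDist_le_gwDist_of_mem {v : V} (hv : v ∈ S) (u : V) :
    comDist G S v u ≤ gwDist G S u := by
  have h : gwDist G S v ≤ G.dist v v := gwDist_le hv v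
  rw [SimpleGraph.dist_self] at h
  unfold comDist
  omega

section Erase

variable [DecidableEq V]

lemma gwDist_eq_dist_or_erase_le {v : V} (hS : S.Nonempty) (u : V) :
    gwDist G S u = G.dist u v ∨ gwDist G (S.erase v) u ≤ gwDist G S u := by
  obtain ⟨s, hs, h⟩ := exists_gwDist_eq (G := G) hS u
  rcases eq_or_ne s v with rfl | hsv
  · exact .inl h
  · exact .inr (h ▸ gwDist_le (mem_erase.mpr ⟨hsv, hs⟩) u)

/-- If closing `v` does not hurt `v`, then it hurts nobody. -/
lemma comDist_erase_le {v : V} (hG : G.Connected) (hv : v ∈ S) (hS : (S.erase v).Nonempty)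
    (h : ∀ u, comDist G (S.erase v) v u ≤ comDist G S v u) (a b : V) :
    comDist G (S.erase v) a b ≤ comDist G S a b := by
  have ha := comDist_le_dist_add hG hS a v b
  have hb := comDist_le_dist_add hG hS b v a
  rw [comDist_comm b a] at hb
  have ha' := (h a).trans (comDist_le_gwDist_of_mem hv a)
  have hb' := (h b).trans (comDist_le_gwDist_of_mem hv b)
  have h₁ : comDist G (S.erase v) a b ≤ G.dist a b := min_le_left _ _
  have h₂ : comDist G (S.erase v) a b ≤ gwDist G (S.erase v) a + gwDist G (S.erase v) b :=
    min_le_right _ _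
  refine le_min h₁ ?_
  rcases gwDist_eq_dist_or_erase_le (G := G) (v := v) ⟨v, hv⟩ a with h₃ | h₃
  · omega
  · rcases gwDist_eq_dist_or_erase_le (G := G) (v := v) ⟨v, hv⟩ b with h₄ | h₄ <;> omega

end Erase

variable [Fintype V]

/-- The total distance of `v` to all nodes. -/
noncomputable def distSum (G : SimpleGraph V) (S : Finset V) (v : V) : ℕ :=
  ∑ u, comDist G S v u

lemma sumCost_eq [DecidableEq V] (α : ℝ) (v : V) :
    sumCost G α S v = (if v ∈ S then α else 0) + (distSum G S v : ℝ) := by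
  simp [sumCost, distSum]

lemma distSum_le_card_mul_diam (hG : G.Connected) (v : V) :
    distSum G S v ≤ Fintype.card V * G.diam := by
  have : Nonempty V := ⟨v⟩
  refine (sum_le_card_nsmul univ _ G.diam fun u _ => ?_).trans_eq (by simp)
  exact (min_le_left _ _).trans
    (SimpleGraph.dist_le_diam (SimpleGraph.connected_iff_ediam_ne_top.mp hG))

variable [DecidableEq V]

/-- If `α < 1`, the total distance decreases, or it does not increase and a gateway closes. -/
lemma potential_lt {α : ℝ} (hG : G.Connected) (hα : 0 < α) (h1 : α < 1) (hS : S.Nonempty)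
    (h : SumIR G α S T) :
    (∑ v, distSum G T v) * (Fintype.card V + 1) + #T <
      (∑ v, distSum G S v) * (Fintype.card V + 1) + #S := by
  obtain ⟨v, ⟨hv, rfl⟩ | ⟨hv, rfl, hne⟩, hc⟩ := h
  · have hlt : distSum G (insert v S) v < distSum G S v := by
      simp only [sumCost_eq, mem_insert_self, hv, if_true, if_false] at hc
      exact_mod_cast (by linarith : (distSum G (insert v S) v : ℝ) < distSum G S v)
    have hsum : ∑ u, distSum G (insert v S) u < ∑ u, distSum G S u :=
      sum_lt_sum (fun u _ => sum_le_sum fun w _ => comDist_anti hS (subset_insert v S) u w)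
        ⟨v, mem_univ v, hlt⟩
    have hcard := card_le_univ (insert v S)
    nlinarith
  · have hle : distSum G (S.erase v) v ≤ distSum G S v := by
      simp only [sumCost_eq, notMem_erase, hv, if_true, if_false] at hc
      have : (distSum G (S.erase v) v : ℝ) < (distSum G S v + 1 : ℕ) := by
        push_cast
        linarith
      exact Nat.lt_succ_iff.mp (by exact_mod_cast this)
    have hmono : ∀ u ∈ univ, comDist G S v u ≤ comDist G (S.erase v) v u :=
      fun u _ => comDist_anti hne (erase_subset v S) v u
    have heq := (sum_eq_sum_iff_of_le hmono).mp ((sum_le_sum hmono).antisymm hle)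
    have hsum : ∑ u, distSum G (S.erase v) u ≤ ∑ u, distSum G S u :=
      sum_le_sum fun a _ => sum_le_sum fun b _ =>
        comDist_erase_le hG hv hne (fun u => (heq u (mem_univ u)).ge) a b
    have hcard := card_erase_lt_of_mem hv
    exact add_lt_add_of_le_of_lt (Nat.mul_le_mul_right _ hsum) hcard

/-- If `α > n * diam G`, every improving response closes a gateway. -/
lemma card_lt {α : ℝ} (hG : G.Connected) (hα : α > (Fintype.card V : ℝ) * (G.diam : ℝ))
    (h : SumIR G α S T) : #T < #S := by
  obtain ⟨v, ⟨hv, rfl⟩ | ⟨hv, rfl, -⟩, hc⟩ := h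
  · simp only [sumCost_eq, mem_insert_self, hv, if_true, if_false] at hc
    have hle : (distSum G S v : ℝ) ≤ Fintype.card V * G.diam := by
      exact_mod_cast distSum_le_card_mul_diam hG v
    have : (0 : ℝ) ≤ distSum G (insert v S) v := Nat.cast_nonneg _
    linarith
  · exact card_erase_lt_of_mem hv

lemma SumIR.nonempty {α : ℝ} (h : SumIR G α S T) : T.Nonempty := by
  obtain ⟨v, ⟨-, rfl⟩ | ⟨-, rfl, hne⟩, -⟩ := h
  · exact insert_nonempty v S
  · exact hne

end GatewayGame

/-- If α < 1 or α > n·diam(G), the SUM-game has the finite improvement property: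
there is no infinite sequence of improving responses. -/
theorem stmt_4 {V : Type*} [Fintype V] [DecidableEq V] (G : SimpleGraph V)
    (hG : G.Connected) (α : ℝ) (hα : 0 < α)
    (h : α < 1 ∨ α > (Fintype.card V : ℝ) * (G.diam : ℝ)) :
    ¬ ∃ seq : ℕ → Finset V, (seq 0).Nonempty ∧
        ∀ i, SumIR G α (seq i) (seq (i + 1)) := by
  rintro ⟨seq, h0, hstep⟩
  have hne : ∀ i, (seq i).Nonempty
    | 0 => h0
    | i + 1 => GatewayGame.SumIR.nonempty (hstep i)
  rcases h with h | h
  · exact not_strictAnti_of_wellFoundedLT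
      (fun i => (∑ v, GatewayGame.distSum G (seq i) v) * (Fintype.card V + 1) + #(seq i))
      (strictAnti_nat_of_succ_lt fun i => GatewayGame.potential_lt hG hα h (hne i) (hstep i))
  · exact not_strictAnti_of_wellFoundedLT (fun i => #(seq i)) (strictAnti_nat_of_succ_lt fun i =>
      GatewayGame.card_lt hG h (hstep i))
end

section
/- Let S be an initial set of gateways with |S| = 1. If diam(G) > 2α + 1 and 4 ≤ α ≤ n−1, then there exists a finite sequence of improving responses in the SUM-game starting from S that ends in a Nash equilibrium. -/
open Finset

lemma gwDist_le {V : Type*} (G : SimpleGraph V) {S : Finset V} {s : V} (hs : s ∈ S) (u : V) :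
    gwDist G S u ≤ G.dist u s :=
  Nat.sInf_le ⟨s, hs, rfl⟩

lemma exists_gwDist_eq {V : Type*} (G : SimpleGraph V) {S : Finset V} (hS : S.Nonempty) (u : V) :
    ∃ s ∈ S, gwDist G S u = G.dist u s := by
  obtain ⟨s, hs, h⟩ := Nat.sInf_mem (s := (fun s => G.dist u s) '' (S : Set V))
    ((Finset.coe_nonempty.2 hS).image _)
  exact ⟨s, hs, h.symm⟩

lemma gwDist_of_mem {V : Type*} (G : SimpleGraph V) {S : Finset V} {u : V} (hu : u ∈ S) :
    gwDist G S u = 0 := by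
  simpa using gwDist_le G hu u

lemma gwDist_pos {V : Type*} {G : SimpleGraph V} (hG : G.Connected) {S : Finset V}
    (hS : S.Nonempty) {u : V} (hu : u ∉ S) : 0 < gwDist G S u := by
  obtain ⟨s, hs, h⟩ := exists_gwDist_eq G hS u
  rw [h]
  exact hG.pos_dist_of_ne (ne_of_mem_of_not_mem hs hu).symm

lemma gwDist_le_dist_add {V : Type*} {G : SimpleGraph V} (hG : G.Connected) {S : Finset V}
    (hS : S.Nonempty) (u v : V) : gwDist G S u ≤ G.dist u v + gwDist G S v := by
  obtain ⟨s, hs, h⟩ := exists_gwDist_eq G hS v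
  rw [h]
  exact (gwDist_le G hs u).trans hG.dist_triangle

/-- If opening `v` is not improving, any lower bound `w` on the pointwise savings, supported on
a set `A`, sums to at most `α`. -/
lemma sum_le_of_not_improving {V : Type*} [Fintype V] [DecidableEq V] {G : SimpleGraph V}
    {α : ℝ} {S : Finset V} (hS : S.Nonempty) {v : V} (hv : v ∉ S)
    (h : ¬ SumIR G α S (insert v S)) (A : Finset V) (w : ℕ)
    (hw : ∀ u ∈ A, min (G.dist v u) (gwDist G S u) + w
      ≤ min (G.dist v u) (gwDist G S v + gwDist G S u)) :
    ((#A * w : ℕ) : ℝ) ≤ α := by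
  have hcost : sumCost G α S v ≤ sumCost G α (insert v S) v := by
    by_contra! hlt
    exact h ⟨v, Or.inl ⟨hv, rfl⟩, hlt⟩
  have hpt : ∀ u, comDist G (insert v S) v u + (if u ∈ A then w else 0) ≤ comDist G S v u := by
    intro u
    have h1 : gwDist G (insert v S) v = 0 := gwDist_of_mem G (mem_insert_self v S)
    have h2 : gwDist G (insert v S) u ≤ gwDist G S u := by
      obtain ⟨s, hs, h⟩ := exists_gwDist_eq G hS u
      exact h ▸ gwDist_le G (mem_insert_of_mem hs) u
    unfold comDist
    rw [h1]
    split_ifs with hu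
    · have := hw u hu
      omega
    · omega
  have hsum := Finset.sum_le_sum (s := univ) fun u _ => hpt u
  rw [Finset.sum_add_distrib, Finset.sum_ite_mem, univ_inter, sum_const, smul_eq_mul] at hsum
  have hsum' : ((∑ u, comDist G (insert v S) v u + #A * w : ℕ) : ℝ)
      ≤ (∑ u, comDist G S v u : ℕ) := Nat.cast_le.2 hsum
  push_cast at hsum' ⊢
  simp only [sumCost, hv, mem_insert_self, if_true, if_false] at hcost
  linarith

lemma card_mul_gwDist_le {V : Type*} [Fintype V] [DecidableEq V] {G : SimpleGraph V}
    {α : ℝ} {S : Finset V} (hS : S.Nonempty) {v : V} (hv : v ∉ S)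
    (h : ¬ SumIR G α S (insert v S)) : ((#S * gwDist G S v : ℕ) : ℝ) ≤ α := by
  refine sum_le_of_not_improving hS hv h S _ fun u hu => ?_
  have h1 := gwDist_le G hu v
  have h2 := gwDist_of_mem G hu
  omega

lemma card_le_of_gwDist_lt_dist {V : Type*} [Fintype V] [DecidableEq V] {G : SimpleGraph V}
    (hG : G.Connected) {α : ℝ} {S : Finset V} (hS : S.Nonempty) {v : V} (hv : v ∉ S)
    (h : ¬ SumIR G α S (insert v S)) (A : Finset V)
    (hA : ∀ u ∈ A, gwDist G S u < G.dist v u) : (#A : ℝ) ≤ α := by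
  have := sum_le_of_not_improving hS hv h A 1 fun u hu => ?_
  · simpa using this
  · have h1 := hA u hu
    have h2 := gwDist_pos hG hS hv
    omega

lemma exists_geodesic {V : Type*} [Finite V] {G : SimpleGraph V} (hG : G.Connected) :
    ∃ x : ℕ → V, ∀ i j, i ≤ j → j ≤ G.diam → G.dist (x i) (x j) = j - i := by
  have := hG.nonempty
  obtain ⟨u, v, huv⟩ := G.exists_dist_eq_diam
  obtain ⟨p, hp⟩ := hG.exists_walk_length_eq_dist u v
  have hle : ∀ i j, i ≤ j → G.dist (p.getVert i) (p.getVert j) ≤ j - i := by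
    intro i j hij
    induction j, hij using Nat.le_induction with
    | base => simp
    | succ j hij ih =>
      have h1 : G.dist (p.getVert j) (p.getVert (j + 1)) ≤ 1 := by
        by_cases hj : j < p.length
        · exact (SimpleGraph.dist_eq_one_iff_adj.2 (p.adj_getVert_succ hj)).le
        · rw [p.getVert_of_length_le (by omega), p.getVert_of_length_le (by omega)]
          simp
      have h2 : G.dist (p.getVert i) (p.getVert (j + 1))
        ≤ G.dist (p.getVert i) (p.getVert j) + _ := hG.dist_triangle
      omega
  refine ⟨p.getVert, fun i j hij hj => le_antisymm (hle i j hij) ?_⟩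
  have h1 := hle 0 i (by omega)
  have h2 := hle j p.length (by omega)
  rw [p.getVert_zero] at h1
  rw [p.getVert_length] at h2
  have h3 : G.dist u v ≤ G.dist u (p.getVert i) + G.dist (p.getVert i) v := hG.dist_triangle
  have h4 : G.dist (p.getVert i) v ≤ G.dist (p.getVert i) (p.getVert j) + _ := hG.dist_triangle
  omega

/-- A nonempty profile at which no opening is improving contains every node. -/
lemma eq_univ_of_no_opening {V : Type*} [Fintype V] [DecidableEq V] {G : SimpleGraph V}
    (hG : G.Connected) {α : ℝ} {S : Finset V} (hdiam : (G.diam : ℝ) > 2 * α + 1) (hα : 0 ≤ α)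
    (hS : S.Nonempty) (hstable : ∀ v ∉ S, ¬ SumIR G α S (insert v S)) : S = univ := by
  by_contra hne
  obtain ⟨y, hy⟩ : ∃ y, y ∉ S := by simpa [Finset.eq_univ_iff_forall] using hne
  have hcard : (#S : ℝ) ≤ α := by
    refine card_le_of_gwDist_lt_dist hG hS hy (hstable y hy) S fun u hu => ?_
    rw [gwDist_of_mem G hu]
    exact hG.pos_dist_of_ne (ne_of_mem_of_not_mem hu hy).symm
  set a := ⌊α⌋₊ with ha
  have hk : #S ≤ a := Nat.le_floor hcard
  have hk0 : 1 ≤ #S := hS.card_pos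
  have hL : 2 * a + 2 ≤ G.diam := by
    have : ((2 * a + 1 : ℕ) : ℝ) < G.diam := by
      push_cast
      linarith [Nat.floor_le hα]
    have : 2 * a + 1 < G.diam := by exact_mod_cast this
    omega
  obtain ⟨x, hx⟩ := exists_geodesic hG
  set m := G.diam - a with hm
  have hg : #S * gwDist G S (x m) ≤ a := by
    by_cases hxm : x m ∈ S
    · simp [gwDist_of_mem G hxm]
    · exact Nat.le_floor (card_mul_gwDist_le hS hxm (hstable _ hxm))
  have hinj : Set.InjOn x (Set.Iic G.diam) := by
    have : ∀ i j, i ≤ j → j ≤ G.diam → x i = x j → i = j := by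
      intro i j hij hj h
      have := hx i j hij hj
      rw [h, SimpleGraph.dist_self] at this
      omega
    intro i hi j hj h
    rcases le_total i j with hij | hij
    · exact this i j hij hj h
    · exact (this j i hij hi h.symm).symm
  have hmem : ∀ i, i + gwDist G S (x m) < m → x i ∈ S := by
    intro i hi
    by_contra hxi
    have h := card_le_of_gwDist_lt_dist hG hS hxi (hstable _ hxi) ((Icc m G.diam).image x) ?_
    · rw [card_image_of_injOn (hinj.mono fun j hj => (mem_Icc.1 hj).2), Nat.card_Icc] at h
      have := Nat.le_floor h
      omega
    · intro u hu
      obtain ⟨j, hj, rfl⟩ := mem_image.1 hu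
      rw [mem_Icc] at hj
      have h1 := gwDist_le_dist_add hG hS (x j) (x m)
      rw [SimpleGraph.dist_comm, hx m j hj.1 hj.2] at h1
      rw [hx i j (by omega) hj.2]
      omega
  have hcount : m - gwDist G S (x m) ≤ #S := by
    have hsub : (range (m - gwDist G S (x m))).image x ⊆ S := by
      intro u hu
      obtain ⟨i, hi, rfl⟩ := mem_image.1 hu
      rw [mem_range] at hi
      exact hmem i (by omega)
    have h := card_le_card hsub
    rwa [card_image_of_injOn, card_range] at h
    refine hinj.mono fun i hi => ?_
    have := mem_range.1 hi
    simp only [Set.mem_Iic]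
    omega
  have hbound : a + 2 ≤ #S + gwDist G S (x m) := by omega
  nlinarith

lemma sumNash_univ {V : Type*} [Fintype V] [DecidableEq V] {G : SimpleGraph V}
    (hG : G.Connected) {α : ℝ} (hα : α ≤ (Fintype.card V : ℝ) - 1) : SumNash G α univ := by
  rintro S' ⟨v, ⟨hv, -⟩ | ⟨-, rfl, hne⟩, hlt⟩
  · exact hv (mem_univ v)
  have h1 : sumCost G α univ v = α := by
    simp [sumCost, comDist, gwDist_of_mem]
  have h2 : ((#(univ.erase v) : ℕ) : ℝ) ≤ sumCost G α (univ.erase v) v := by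
    have hpt : ∀ u, (if u ∈ univ.erase v then 1 else 0) ≤ comDist G (univ.erase v) v u := by
      intro u
      split_ifs with hu
      · have := gwDist_pos hG hne (notMem_erase v univ)
        have := hG.pos_dist_of_ne (ne_of_mem_erase hu).symm
        unfold comDist
        omega
      · exact Nat.zero_le _
    have hsum := Finset.sum_le_sum (s := univ) fun u _ => hpt u
    rw [Finset.sum_ite_mem, univ_inter, ← card_eq_sum_ones] at hsum
    simp only [sumCost, notMem_erase, if_false, zero_add]
    exact_mod_cast hsum
  rw [card_erase_of_mem (mem_univ v), card_univ, Nat.cast_sub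
    (Fintype.card_pos_iff.2 hG.nonempty)] at h2
  push_cast at h2
  linarith

lemma exists_no_opening {V : Type*} [Fintype V] [DecidableEq V] (G : SimpleGraph V) (α : ℝ)
    (S : Finset V) : ∃ T, S ⊆ T ∧ Relation.ReflTransGen (SumIR G α) S T ∧
      ∀ v ∉ T, ¬ SumIR G α T (insert v T) := by
  induction hn : Fintype.card V - #S using Nat.strong_induction_on generalizing S with
  | _ n ih =>
    by_cases h : ∀ v ∉ S, ¬ SumIR G α S (insert v S)
    · exact ⟨S, Subset.rfl, .refl, h⟩
    · push Not at h
      obtain ⟨v, hv, hIR⟩ := h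
      have h1 := card_insert_of_notMem hv
      have h2 := card_le_univ (insert v S)
      obtain ⟨T, hT, hST, hstable⟩ := ih _ (by omega) (insert v S) rfl
      exact ⟨T, (subset_insert v S).trans hT, .head hIR hST, hstable⟩

lemma Relation.ReflTransGen.exists_seq {β : Type*} {r : β → β → Prop} {a b : β}
    (h : Relation.ReflTransGen r a b) :
    ∃ (k : ℕ) (seq : ℕ → β), seq 0 = a ∧ (∀ i < k, r (seq i) (seq (i + 1))) ∧ seq k = b := by
  induction h using Relation.ReflTransGen.head_induction_on with
  | refl => exact ⟨0, fun _ => b, rfl, by simp, rfl⟩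
  | @head a c hac _ ih =>
    obtain ⟨k, seq, h0, hr, hk⟩ := ih
    refine ⟨k + 1, fun i => Nat.casesOn i a seq, rfl, fun i hi => ?_, hk⟩
    cases i with
    | zero => simpa [h0] using hac
    | succ i => exact hr i (by omega)

/-- If |S| = 1, diam(G) > 2α + 1, and 4 ≤ α ≤ n−1, then from S there exists a finite
sequence of improving responses of the SUM-game ending in a Nash equilibrium. -/
theorem stmt_6 {V : Type*} [Fintype V] [DecidableEq V] (G : SimpleGraph V)
    (hG : G.Connected) (α : ℝ)
    (S : Finset V) (hcard : S.card = 1)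
    (hdiam : (G.diam : ℝ) > 2 * α + 1)
    (hα4 : 4 ≤ α) (hαn : α ≤ (Fintype.card V : ℝ) - 1) :
    ∃ (k : ℕ) (seq : ℕ → Finset V), seq 0 = S ∧
      (∀ i < k, SumIR G α (seq i) (seq (i + 1))) ∧ SumNash G α (seq k) := by
  obtain ⟨T, hST, hreach, hstable⟩ := exists_no_opening G α S
  have hS : S.Nonempty := card_pos.1 (by omega)
  have hT := eq_univ_of_no_opening hG hdiam (by linarith) (hS.mono hST) hstable
  obtain ⟨k, seq, h0, hstep, hk⟩ := hreach.exists_seq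
  exact ⟨k, seq, h0, hstep, by rw [hk, hT]; exact sumNash_univ hG hαn⟩
end

section
/- For every integer n > 7 and every real α with 4 < α < n−1, there exist a finite connected simple graph G on n vertices, an initial nonempty profile S_0, and an infinite sequence of profiles S_0, S_1, S_2, … in which each S_{i+1} arises from S_i by an improving response of the SUM-game on G; hence the SUM-game is not a finite improvement property game in general for this range of α. -/
open Finset

/-- The class of a vertex of the double star: `0` for a leaf at the first centre, `1` and `2` for
the two centres, `3` for a leaf at the second centre. -/
def starClass (p i : ℕ) : ℕ :=
  if i < p then 0 else if i = p then 1 else if i = p + 1 then 2 else 3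

/-- The double star whose adjacent centres `p` and `p + 1` have `p` and `n - p - 2` leaves. -/
def doubleStar (p n : ℕ) : SimpleGraph (Fin n) where
  Adj u v := starClass p u + 1 = starClass p v ∨ starClass p v + 1 = starClass p u
  symm := ⟨fun _ _ h => h.symm⟩
  loopless := ⟨fun _ h => by omega⟩

/-- The vertices of the double star whose class lies in `P`. -/
def classSet (p n : ℕ) (P : Finset ℕ) : Finset (Fin n) :=
  univ.filter fun u => starClass p u ∈ P

/-- Distance in the double star, in terms of classes. -/
def starDist (p n : ℕ) (u v : Fin n) : ℕ :=
  if u = v then 0 else if starClass p u = starClass p v then 2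
  else (starClass p u - starClass p v) + (starClass p v - starClass p u)

/-- A function that is zero on the diagonal, grows by at most one along edges, and can always be
decreased by moving to a neighbour, is the graph distance, and the graph is connected. -/
theorem SimpleGraph.reachable_and_dist_eq {V : Type*} {G : SimpleGraph V} {D : V → V → ℕ}
    (h0 : ∀ u, D u u = 0) (hstep : ∀ u v w, G.Adj v w → D u w ≤ D u v + 1)
    (hdown : ∀ u v, u ≠ v → ∃ w, G.Adj w v ∧ D u w + 1 = D u v) (u v : V) :
    G.Reachable u v ∧ G.dist u v = D u v := by
  have hup : ∀ k v, D u v = k → ∃ q : G.Walk u v, q.length = k := by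
    intro k
    induction k with
    | zero =>
      intro v hv
      by_cases huv : u = v
      · subst huv
        exact ⟨.nil, rfl⟩
      · obtain ⟨w, -, hw⟩ := hdown u v huv
        omega
    | succ k ih =>
      intro v hv
      by_cases huv : u = v
      · subst huv
        have := h0 u
        omega
      · obtain ⟨w, hwv, hw⟩ := hdown u v huv
        obtain ⟨q, hq⟩ := ih w (by omega)
        exact ⟨q.concat hwv, by simp [hq]⟩
  have hlow : ∀ x y (q : G.Walk x y), D u y ≤ D u x + q.length := by
    intro x y q
    induction q with
    | nil => simp
    | cons h q ih =>
      have := hstep u _ _ h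
      simp only [SimpleGraph.Walk.length_cons]
      omega
  obtain ⟨q, hq⟩ := hup _ v rfl
  refine ⟨q.reachable, le_antisymm (hq ▸ SimpleGraph.dist_le q) ?_⟩
  obtain ⟨r, hr⟩ := q.reachable.exists_walk_length_eq_dist
  have := hlow u v r
  rw [h0] at this
  omega

theorem doubleStar_reachable_and_dist_eq {p n : ℕ} (hp : p + 2 ≤ n) (u v : Fin n) :
    (doubleStar p n).Reachable u v ∧ (doubleStar p n).dist u v = starDist p n u v := by
  refine SimpleGraph.reachable_and_dist_eq (D := starDist p n) ?_ ?_ ?_ u v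
  · intro u
    simp [starDist]
  · intro u v w h
    have hlt : ∀ x : Fin n, starClass p x < 4 := fun x => by
      unfold starClass
      split_ifs <;> omega
    have hinj : ∀ x y : Fin n, x ≠ y → starClass p x = starClass p y →
        starClass p x = 0 ∨ starClass p x = 3 := fun x y hxy hc => by
      have hxy' : (x : ℕ) ≠ y := fun h => hxy (Fin.ext h)
      unfold starClass at hc ⊢
      split_ifs at hc ⊢ <;> omega
    have hu := hlt u
    have hv := hlt v
    have hw := hlt w
    have huv := hinj u v
    simp only [doubleStar] at h
    unfold starDist
    by_cases h1 : u = v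
    · subst h1
      split_ifs <;> omega
    · split_ifs with h2
      · omega
      all_goals omega
  · intro u v huv
    have huv' : (u : ℕ) ≠ v := fun h => huv (Fin.ext h)
    by_cases hv0 : (v : ℕ) < p
    · refine ⟨⟨p, by omega⟩, ?_⟩
      simp only [doubleStar, starDist, starClass, Fin.ext_iff]
      split_ifs <;> first | omega | contradiction
    by_cases hv3 : p + 1 < (v : ℕ)
    · refine ⟨⟨p + 1, by omega⟩, ?_⟩
      simp only [doubleStar, starDist, starClass, Fin.ext_iff]
      split_ifs <;> first | omega | contradiction
    by_cases hv1 : (v : ℕ) = p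
    · by_cases hu : (u : ℕ) < p
      · refine ⟨u, ?_⟩
        simp only [doubleStar, starDist, starClass, Fin.ext_iff]
        split_ifs <;> first | omega | contradiction
      · refine ⟨⟨p + 1, by omega⟩, ?_⟩
        simp only [doubleStar, starDist, starClass, Fin.ext_iff]
        split_ifs <;> omega
    · by_cases hu : p + 1 < (u : ℕ)
      · refine ⟨u, ?_⟩
        simp only [doubleStar, starDist, starClass, Fin.ext_iff]
        split_ifs <;> omega
      · refine ⟨⟨p, by omega⟩, ?_⟩
        simp only [doubleStar, starDist, starClass, Fin.ext_iff]
        split_ifs <;> first | omega | contradiction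

theorem gwDist_eq {V : Type*} {G : SimpleGraph V} {S : Finset V} {u s : V} {k : ℕ}
    (hs : s ∈ S) (hk : G.dist u s = k) (hle : ∀ t ∈ S, k ≤ G.dist u t) : gwDist G S u = k := by
  apply le_antisymm
  · exact Nat.sInf_le ⟨s, hs, hk⟩
  · refine le_csInf ⟨_, s, hs, rfl⟩ ?_
    rintro _ ⟨t, ht, rfl⟩
    exact hle t ht

theorem sum_starClass (p q : ℕ) (g : ℕ → ℝ) :
    ∑ u : Fin (p + 2 + q), g (starClass p u) = p * g 0 + g 1 + g 2 + q * g 3 := by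
  rw [Fin.sum_univ_eq_sum_range (fun i => g (starClass p i)), sum_range_add, sum_range_succ,
    sum_range_succ]
  have h0 : ∑ i ∈ range p, g (starClass p i) = p * g 0 := by
    rw [sum_congr rfl (g := fun _ => g 0)]
    · simp
    · intro i hi
      simp [starClass, mem_range.1 hi]
  have h3 : ∑ i ∈ range q, g (starClass p (p + 2 + i)) = q * g 3 := by
    rw [sum_congr rfl (g := fun _ => g 3)]
    · simp
    · intro i _
      congr 1
      simp only [starClass]
      split_ifs <;> omega
  rw [h0, h3]
  simp [starClass]

theorem gwDist_classSet {p n : ℕ} (hp0 : 0 < p) (hp : p + 2 ≤ n) {P : Finset ℕ} {k : ℕ → ℕ}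
    (hP : ∀ i ∈ P, i < 3) (hle : ∀ i ∈ P, ∀ j < 4, k j ≤ (j - i) + (i - j))
    (hex : ∀ j < 4, ∃ i ∈ P, (j - i) + (i - j) = k j) (u : Fin n) :
    gwDist (doubleStar p n) (classSet p n P) u = k (starClass p u) := by
  have hd : ∀ v, (doubleStar p n).dist u v = starDist p n u v :=
    fun v => (doubleStar_reachable_and_dist_eq hp u v).2
  have hu4 : starClass p u < 4 := by
    unfold starClass
    split_ifs <;> omega
  obtain ⟨i, hiP, hi⟩ := hex _ hu4
  obtain ⟨s, hs, hsd⟩ : ∃ s : Fin n, starClass p s = i ∧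
      starDist p n u s = (starClass p u - i) + (i - starClass p u) := by
    by_cases hui : starClass p u = i
    · exact ⟨u, hui, by simp [starDist, hui]⟩
    · obtain ⟨s, hs⟩ : ∃ s : Fin n, starClass p s = i := by
        have := hP i hiP
        interval_cases i
        · exact ⟨⟨0, by omega⟩, by simp [starClass, hp0]⟩
        · exact ⟨⟨p, by omega⟩, by simp [starClass]⟩
        · exact ⟨⟨p + 1, by omega⟩, by simp [starClass]⟩
      have hus : u ≠ s := by
        rintro rfl
        exact hui hs
      exact ⟨s, hs, by simp [starDist, hus, hs, hui]⟩
  refine gwDist_eq (s := s) (by simp [classSet, hs, hiP]) (by rw [hd, hsd, hi]) ?_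
  intro t ht
  have hkt := hle _ (mem_filter.1 ht).2 _ hu4
  rw [hd]
  unfold starDist
  split_ifs with h1 h2
  · subst h1
    omega
  · omega
  · exact hkt

theorem sumCost_classSet {p q c : ℕ} (α : ℝ) (hp0 : 0 < p) {P : Finset ℕ} {k : ℕ → ℕ}
    (hP : ∀ i ∈ P, i < 3) (hle : ∀ i ∈ P, ∀ j < 4, k j ≤ (j - i) + (i - j))
    (hex : ∀ j < 4, ∃ i ∈ P, (j - i) + (i - j) = k j) {v : Fin (p + 2 + q)}
    (hv : (v : ℕ) = p ∨ (v : ℕ) = p + 1) (hc : starClass p v = c) :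
    sumCost (doubleStar p (p + 2 + q)) α (classSet p _ P) v =
      (if c ∈ P then α else 0) + (p * (min (c - 0 + (0 - c)) (k c + k 0) : ℕ) +
        (min (c - 1 + (1 - c)) (k c + k 1) : ℕ) + (min (c - 2 + (2 - c)) (k c + k 2) : ℕ) +
        q * (min (c - 3 + (3 - c)) (k c + k 3) : ℕ)) := by
  subst hc
  unfold sumCost
  congr 1
  · simp [classSet]
  rw [← sum_starClass p q (fun j => ((min (starClass p v - j + (j - starClass p v))
    (k (starClass p v) + k j) : ℕ) : ℝ))]
  refine sum_congr rfl fun u _ => ?_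
  have hdist : starDist p (p + 2 + q) v u =
      starClass p v - starClass p u + (starClass p u - starClass p v) := by
    simp only [starDist, starClass, Fin.ext_iff]
    split_ifs <;> first | omega | contradiction
  rw [comDist, (doubleStar_reachable_and_dist_eq (by omega) v u).2, hdist,
    gwDist_classSet hp0 (by omega) hP hle hex, gwDist_classSet hp0 (by omega) hP hle hex]

theorem classSet_insert {p n c : ℕ} {P Q : Finset ℕ} {v : Fin n} (hc : starClass p v = c)
    (hv : (v : ℕ) = p ∨ (v : ℕ) = p + 1) (hQ : Q = insert c P) :
    classSet p n Q = insert v (classSet p n P) := by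
  have huniq : ∀ u : Fin n, starClass p u = c ↔ u = v := by
    intro u
    subst hc
    simp only [starClass, Fin.ext_iff]
    constructor <;> intro h <;> split_ifs at h ⊢ <;> omega
  ext u
  simp [classSet, hQ, huniq]

/-- The double star has an improving-response cycle of length four. -/
theorem exists_sumIR_cycle {p q : ℕ} {α : ℝ} (hp0 : 0 < p) (h1 : p + 1 < α) (h2 : α < 2 * p)
    (h3 : α < p + 1 + q) :
    SumIR (doubleStar p (p + 2 + q)) α (classSet p _ {0}) (classSet p _ {0, 2}) ∧
    SumIR (doubleStar p (p + 2 + q)) α (classSet p _ {0, 2}) (classSet p _ {0, 1, 2}) ∧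
    SumIR (doubleStar p (p + 2 + q)) α (classSet p _ {0, 1, 2}) (classSet p _ {0, 1}) ∧
    SumIR (doubleStar p (p + 2 + q)) α (classSet p _ {0, 1}) (classSet p _ {0}) := by
  obtain ⟨z, hz⟩ : ∃ z : Fin (p + 2 + q), (z : ℕ) = p := ⟨⟨p, by omega⟩, rfl⟩
  obtain ⟨a, ha⟩ : ∃ a : Fin (p + 2 + q), (a : ℕ) = p + 1 := ⟨⟨p + 1, by omega⟩, rfl⟩
  have hz1 : starClass p z = 1 := by simp [starClass, hz]
  have ha2 : starClass p a = 2 := by simp [starClass, ha]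
  have hne : ∀ P : Finset ℕ, 0 ∈ P → (classSet p (p + 2 + q) P).Nonempty := fun P hP =>
    ⟨⟨0, by omega⟩, mem_filter.2 ⟨mem_univ _, by simp [starClass, hp0, hP]⟩⟩
  have cost1 := fun v hv c hc => sumCost_classSet (p := p) (q := q) (c := c) (P := {0})
    (k := fun j => j) α hp0 (by decide) (by decide) (by decide) (v := v) hv hc
  have cost2 := fun v hv c hc => sumCost_classSet (p := p) (q := q) (c := c) (P := {0, 2})
    (k := fun j => j % 2) α hp0 (by decide) (by decide) (by decide) (v := v) hv hc
  have cost3 := fun v hv c hc => sumCost_classSet (p := p) (q := q) (c := c) (P := {0, 1, 2})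
    (k := fun j => j - 2) α hp0 (by decide) (by decide) (by decide) (v := v) hv hc
  have cost4 := fun v hv c hc => sumCost_classSet (p := p) (q := q) (c := c) (P := {0, 1})
    (k := fun j => j - 1) α hp0 (by decide) (by decide) (by decide) (v := v) hv hc
  have hopen : ∀ P Q (v : Fin (p + 2 + q)) c, starClass p v = c → c ∉ P →
      ((v : ℕ) = p ∨ (v : ℕ) = p + 1) → Q = insert c P →
      v ∉ classSet p _ P ∧ classSet p _ Q = insert v (classSet p _ P) := by
    intro P Q v c hc hcP hv hQ
    exact ⟨by simp [classSet, hc, hcP], classSet_insert hc hv hQ⟩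
  have hclose : ∀ P Q (v : Fin (p + 2 + q)) c, starClass p v = c → c ∉ P → 0 ∈ P →
      ((v : ℕ) = p ∨ (v : ℕ) = p + 1) → Q = insert c P →
      v ∈ classSet p _ Q ∧ classSet p _ P = (classSet p _ Q).erase v ∧
        ((classSet p _ Q).erase v).Nonempty := by
    intro P Q v c hc hcP h0 hv hQ
    obtain ⟨hvP, hins⟩ := hopen P Q v c hc hcP hv hQ
    rw [hins, erase_insert hvP]
    exact ⟨mem_insert_self _ _, rfl, hne P h0⟩
  refine ⟨⟨a, .inl (hopen _ _ a 2 ha2 (by decide) (.inr ha) (by decide)), ?_⟩,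
    ⟨z, .inl (hopen _ _ z 1 hz1 (by decide) (.inl hz) (by decide)), ?_⟩,
    ⟨a, .inr (hclose _ _ a 2 ha2 (by decide) (by decide) (.inr ha) (by decide)), ?_⟩,
    ⟨z, .inr (hclose _ _ z 1 hz1 (by decide) (by decide) (.inl hz) (by decide)), ?_⟩⟩
  · rw [cost1 a (.inr ha) 2 ha2, cost2 a (.inr ha) 2 ha2]
    norm_num
    linarith
  · rw [cost2 z (.inl hz) 1 hz1, cost3 z (.inl hz) 1 hz1]
    norm_num
    linarith
  · rw [cost3 a (.inr ha) 2 ha2, cost4 a (.inr ha) 2 ha2]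
    norm_num
    linarith
  · rw [cost4 z (.inl hz) 1 hz1, cost1 z (.inl hz) 1 hz1]
    norm_num
    linarith

/-- For every n > 7 and 4 < α < n−1 there is a connected graph on n vertices and an
infinite improving-response sequence of the SUM-game: the game is not a FIPG. -/
theorem stmt_7 (n : ℕ) (hn : 7 < n) (α : ℝ) (hα4 : 4 < α) (hαn : α < (n : ℝ) - 1) :
    ∃ G : SimpleGraph (Fin n), G.Connected ∧
      ∃ seq : ℕ → Finset (Fin n), (seq 0).Nonempty ∧
        ∀ i, SumIR G α (seq i) (seq (i + 1)) := by
  have hceil : 5 ≤ ⌈α⌉₊ := Nat.lt_ceil.2 (by exact_mod_cast hα4)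
  obtain ⟨p, hp⟩ : ∃ p, ⌈α⌉₊ = p + 2 := ⟨⌈α⌉₊ - 2, by omega⟩
  have hle : α ≤ p + 2 := by exact_mod_cast hp ▸ Nat.le_ceil α
  have hlt : (p : ℝ) + 1 < α := by
    exact_mod_cast Nat.lt_ceil.1 (show p + 1 < ⌈α⌉₊ by omega)
  have hp3 : (3 : ℝ) ≤ p := by exact_mod_cast (show 3 ≤ p by omega)
  have hpn : p + 2 < n := by
    have : (p : ℝ) + 2 < n := by linarith
    exact_mod_cast this
  obtain ⟨q, rfl⟩ : ∃ q, n = p + 2 + q := ⟨n - (p + 2), by omega⟩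
  have hα : α < p + 1 + q := by
    push_cast at hαn
    linarith
  obtain ⟨c1, c2, c3, c4⟩ := exists_sumIR_cycle (q := q) (by omega) hlt (by linarith) hα
  refine ⟨doubleStar p (p + 2 + q), ?_, fun i => classSet p _ (if i % 4 = 0 then {0}
    else if i % 4 = 1 then {0, 2} else if i % 4 = 2 then {0, 1, 2} else {0, 1}), ?_, ?_⟩
  · exact { preconnected := fun u v => (doubleStar_reachable_and_dist_eq (by omega) u v).1
            nonempty := ⟨⟨0, by omega⟩⟩ }
  · exact ⟨⟨0, by omega⟩, mem_filter.2 ⟨mem_univ _, by simp [starClass, show 0 < p by omega]⟩⟩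
  · intro i
    have hi : i % 4 < 4 := Nat.mod_lt _ (by norm_num)
    have hstep : (i + 1) % 4 = (i % 4 + 1) % 4 := by omega
    simp only [hstep]
    generalize i % 4 = r at hi
    interval_cases r
    exacts [c1, c2, c3, c4]
end

section
/- For every integer n > 16 divisible by 4 and every real α with (3/32)n² + n < α < (5/32)n², there exist a finite connected simple graph G on n vertices, an initial nonempty profile S_0, and an infinite sequence of profiles S_0, S_1, S_2, … in which each S_{i+1} arises from S_i by an improving response of the SUM-game on G; hence the SUM-game is not a finite improvement property game in general for this range of α. -/
open Finset

open SimpleGraph in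
theorem pathGraph_le_add_length {n : ℕ} {u v : Fin n} (w : (pathGraph n).Walk u v) :
    (v : ℕ) ≤ u + w.length ∧ (u : ℕ) ≤ v + w.length := by
  induction w with
  | nil => simp
  | cons h w ih =>
    rw [pathGraph_adj] at h
    rw [Walk.length_cons]
    omega

open SimpleGraph in
theorem pathGraph_dist_le {n : ℕ} (k : ℕ) :
    ∀ u v : Fin n, (v : ℕ) = u + k → (pathGraph n).dist u v ≤ k := by
  induction k with
  | zero =>
    intro u v h
    obtain rfl : v = u := Fin.ext h
    simp
  | succ k ih =>
    intro u v h
    have hw : (u : ℕ) + k < n := by omega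
    obtain ⟨p, hp⟩ :=
      (pathGraph_preconnected n u ⟨u + k, hw⟩).exists_walk_length_eq_dist
    have hadj : (pathGraph n).Adj ⟨u + k, hw⟩ v := by
      rw [pathGraph_adj]
      left
      simp only
      omega
    have h1 := dist_le (p.concat hadj)
    have h2 := ih u ⟨u + k, hw⟩ rfl
    rw [Walk.length_concat] at h1
    omega

open SimpleGraph in
theorem pathGraph_dist {n : ℕ} (u v : Fin n) :
    (pathGraph n).dist u v = ((u : ℕ) - v) + (v - u) := by
  obtain ⟨p, hp⟩ := (pathGraph_preconnected n u v).exists_walk_length_eq_dist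
  have h1 := pathGraph_le_add_length p
  rcases le_total (u : ℕ) v with h | h
  · have h2 := pathGraph_dist_le (v - u : ℕ) u v (by omega)
    omega
  · have h2 := pathGraph_dist_le (u - v : ℕ) v u (by omega)
    rw [dist_comm] at h2
    omega

section Gateways

variable {V : Type*} (G : SimpleGraph V)

theorem gwDist_singleton (s u : V) : gwDist G {s} u = G.dist u s := by
  simp [gwDist]

variable [DecidableEq V]

theorem gwDist_insert {S : Finset V} (hS : S.Nonempty) (s u : V) :
    gwDist G (insert s S) u = min (G.dist u s) (gwDist G S u) := by
  unfold gwDist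
  rw [Finset.coe_insert, Set.image_insert_eq, csInf_insert (OrderBot.bddBelow _)]
  exact (Finset.coe_nonempty.mpr hS).image _

theorem comDist_insert_self {S : Finset V} (hS : S.Nonempty) (v u : V) :
    comDist G (insert v S) v u = min (G.dist v u) (gwDist G S u) := by
  rw [comDist, gwDist_insert G hS, gwDist_insert G hS, SimpleGraph.dist_self,
    SimpleGraph.dist_comm (u := u)]
  omega

variable [Fintype V] {G} {α : ℝ} {S : Finset V} {v : V} {g : V → ℕ}

theorem sumCost_sub_sumCost_insert (hS : S.Nonempty) (hv : v ∉ S)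
    (hg : ∀ u, comDist G S v u = min (G.dist v u) (gwDist G S u) + g u) :
    sumCost G α S v - sumCost G α (insert v S) v = ((∑ u, g u : ℕ) : ℝ) - α := by
  simp only [sumCost, hv, hg, comDist_insert_self G hS, Finset.mem_insert_self, if_true, if_false]
  push_cast
  rw [Finset.sum_add_distrib]
  ring

theorem SumIR.of_open (hS : S.Nonempty) (hv : v ∉ S)
    (hg : ∀ u, comDist G S v u = min (G.dist v u) (gwDist G S u) + g u)
    (hα : α < ((∑ u, g u : ℕ) : ℝ)) : SumIR G α S (insert v S) := by
  have := sumCost_sub_sumCost_insert (α := α) hS hv hg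
  exact ⟨v, Or.inl ⟨hv, rfl⟩, by linarith⟩

theorem SumIR.of_close (hS : S.Nonempty) (hv : v ∉ S)
    (hg : ∀ u, comDist G S v u = min (G.dist v u) (gwDist G S u) + g u)
    (hα : ((∑ u, g u : ℕ) : ℝ) < α) : SumIR G α (insert v S) S := by
  have := sumCost_sub_sumCost_insert (α := α) hS hv hg
  refine ⟨v, Or.inr ⟨Finset.mem_insert_self v S, ?_, ?_⟩, by linarith⟩ <;>
    rw [Finset.erase_insert hv]
  exact hS

end Gateways

theorem sum_range_two_mul_sub_succ_succ (k : ℕ) :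
    ∑ t ∈ range (k + 2), (2 * t - (k + 2)) = ∑ t ∈ range k, (2 * t - k) + k := by
  rw [Finset.sum_range_succ', Finset.sum_range_succ]
  have : ∀ t, 2 * (t + 1) - (k + 2) = 2 * t - k := fun t => by omega
  simp only [this]
  omega

theorem sum_range_sub_two_mul_succ_succ (k : ℕ) :
    ∑ t ∈ range (k + 2), (k + 2 - 2 * t) = ∑ t ∈ range k, (k - 2 * t) + (k + 2) := by
  rw [Finset.sum_range_succ', Finset.sum_range_succ]
  have : ∀ t, k + 2 - 2 * (t + 1) = k - 2 * t := fun t => by omega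
  simp only [this]
  omega

theorem four_mul_sum_range_two_mul_sub (k : ℕ) :
    k ^ 2 ≤ 4 * ∑ t ∈ range k, (2 * t - k) + 2 * k ∧
      4 * ∑ t ∈ range k, (2 * t - k) + 2 * k ≤ k ^ 2 + 1 := by
  induction k using Nat.twoStepInduction with
  | zero => simp
  | one => simp
  | more k ih _ =>
    rw [sum_range_two_mul_sub_succ_succ]
    constructor <;> nlinarith

theorem sq_add_le_four_mul_sum_range_sub_two_mul (k : ℕ) :
    k ^ 2 + 2 * k ≤ 4 * ∑ t ∈ range k, (k - 2 * t) := by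
  induction k using Nat.twoStepInduction with
  | zero => simp
  | one => simp
  | more k ih _ =>
    rw [sum_range_sub_two_mul_succ_succ]
    nlinarith

/-- On a path, the total distance that a node at position `a` saves by opening towards a gateway at
position `a + L` with `r - 1` nodes behind it. -/
theorem sum_min_two_mul_sub (a L r : ℕ) :
    ∑ i ∈ range (a + L + r), min (2 * i - (a + (a + L))) L =
      ∑ t ∈ range L, (2 * t - L) + L * r := by
  rw [Finset.sum_range_add, Finset.sum_range_add]
  have h1 : ∑ i ∈ range a, min (2 * i - (a + (a + L))) L = 0 :=
    Finset.sum_eq_zero fun i hi => by rw [Finset.mem_range] at hi; omega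
  have h2 : ∑ i ∈ range L, min (2 * (a + i) - (a + (a + L))) L = ∑ t ∈ range L, (2 * t - L) :=
    Finset.sum_congr rfl fun i hi => by rw [Finset.mem_range] at hi; omega
  have h3 : ∑ i ∈ range r, min (2 * (a + L + i) - (a + (a + L))) L = ∑ _i ∈ range r, L :=
    Finset.sum_congr rfl fun i _ => by omega
  rw [h1, h2, h3, Finset.sum_const, Finset.card_range, smul_eq_mul]
  ring

theorem sum_min_sub_two_mul (a L r : ℕ) :
    ∑ i ∈ range (a + L + r), min ((a + (a + L)) - 2 * i) L =
      ∑ t ∈ range L, (L - 2 * t) + L * a := by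
  rw [Finset.sum_range_add, Finset.sum_range_add]
  have h1 : ∑ i ∈ range a, min ((a + (a + L)) - 2 * i) L = ∑ _i ∈ range a, L :=
    Finset.sum_congr rfl fun i hi => by rw [Finset.mem_range] at hi; omega
  have h2 : ∑ i ∈ range L, min ((a + (a + L)) - 2 * (a + i)) L = ∑ t ∈ range L, (L - 2 * t) :=
    Finset.sum_congr rfl fun i hi => by rw [Finset.mem_range] at hi; omega
  have h3 : ∑ i ∈ range r, min ((a + (a + L)) - 2 * (a + L + i)) L = 0 :=
    Finset.sum_eq_zero fun i _ => by omega
  rw [h1, h2, h3, Finset.sum_const, Finset.card_range, smul_eq_mul]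
  ring

/-- The number `m` of nodes behind the permanent gateway that makes the improving cycle work. -/
theorem exists_tail_length {k : ℕ} {α : ℝ} (hk : 0 < k)
    (hlo : (3 / 2 : ℝ) * k ^ 2 + 4 * k < α) (hhi : α < (5 / 2 : ℝ) * k ^ 2) :
    ∃ m : ℕ, m + 1 ≤ 2 * k ∧ α < k ^ 2 + k + 2 * k * m ∧
      (5 / 4 : ℝ) * k ^ 2 + k / 2 + 1 / 4 + k * m < α := by
  have hk1 : (1 : ℝ) ≤ k := by exact_mod_cast hk
  have hk0 : (0 : ℝ) < 2 * k := by linarith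
  have h0 : 0 ≤ (α - k ^ 2 - k) / (2 * k) := div_nonneg (by nlinarith) hk0.le
  have hf := Nat.floor_le h0
  have hg := Nat.lt_floor_add_one ((α - k ^ 2 - k) / (2 * k))
  set q := ⌊(α - k ^ 2 - k) / (2 * k)⌋₊
  rw [le_div_iff₀ hk0] at hf
  rw [div_lt_iff₀ hk0] at hg
  refine ⟨q + 1, ?_, ?_, ?_⟩
  · have : (q : ℝ) + 1 < 2 * k := by
      by_contra! h
      nlinarith [mul_le_mul_of_nonneg_right h (by linarith : (0 : ℝ) ≤ k)]
    have : q + 1 < 2 * k := by exact_mod_cast this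
    omega
  · push_cast
    nlinarith
  · push_cast
    nlinarith

/-- What a node at position `a` saves towards position `i` by opening when the only gateway is at
position `a + L`. -/
theorem path_saving_of_single (a L i : ℕ) :
    min (a - i + (i - a)) (a - (a + L) + (a + L - a) + (i - (a + L) + (a + L - i))) =
      min (a - i + (i - a)) (i - (a + L) + (a + L - i)) + min (2 * i - (a + (a + L))) L := by
  omega

/-- What a node at position `p + k` saves towards position `i` by opening between gateways at
positions `p` and `p + 2 * k`. -/
theorem path_saving_of_middle (p k i : ℕ) :
    min (p + k - i + (i - (p + k)))
        (min (p + k - p + (p - (p + k))) (p + k - (p + 2 * k) + (p + 2 * k - (p + k))) +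
          min (i - p + (p - i)) (i - (p + 2 * k) + (p + 2 * k - i))) =
      min (p + k - i + (i - (p + k))) (min (i - p + (p - i)) (i - (p + 2 * k) + (p + 2 * k - i))) +
        (min (2 * i - (p + k + (p + k + k))) k + min (p + (p + k) - 2 * i) k) := by
  rw [show p + k - p + (p - (p + k)) = k by omega,
    show p + k - (p + 2 * k) + (p + 2 * k - (p + k)) = k by omega, min_self]
  rcases le_total i (p + k) with h | h
  · rw [show min (i - p + (p - i)) (i - (p + 2 * k) + (p + 2 * k - i)) = i - p + (p - i) by omega]
    omega
  · rw [show min (i - p + (p - i)) (i - (p + 2 * k) + (p + 2 * k - i)) =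
      i - (p + 2 * k) + (p + 2 * k - i) by omega]
    omega

/-- What a node at position `p` saves towards position `i` by opening when the gateways are at
positions `p + k` and `p + 2 * k`. -/
theorem path_saving_of_far (p k i : ℕ) :
    min (p - i + (i - p))
        (min (p - (p + k) + (p + k - p)) (p - (p + 2 * k) + (p + 2 * k - p)) +
          min (i - (p + k) + (p + k - i)) (i - (p + 2 * k) + (p + 2 * k - i))) =
      min (p - i + (i - p))
          (min (i - (p + k) + (p + k - i)) (i - (p + 2 * k) + (p + 2 * k - i))) +
        min (2 * i - (p + (p + k))) k := by
  rw [show min (p - (p + k) + (p + k - p)) (p - (p + 2 * k) + (p + 2 * k - p)) = k by omega]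
  omega

theorem pathGraph_improving_cycle {p k m n : ℕ} {α : ℝ} (hk : 0 < k) (hn : p + 2 * k + (m + 1) = n)
    (hp : p + (m + 1) = 2 * k) (hhi : α < (5 / 2 : ℝ) * k ^ 2)
    (hopen : α < k ^ 2 + k + 2 * k * m)
    (hclose : (5 / 4 : ℝ) * k ^ 2 + k / 2 + 1 / 4 + k * m < α) :
    ∃ x y z : Fin n,
      SumIR (SimpleGraph.pathGraph n) α {z} {x, z} ∧
      SumIR (SimpleGraph.pathGraph n) α {x, z} {x, y, z} ∧
      SumIR (SimpleGraph.pathGraph n) α {x, y, z} {y, z} ∧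
      SumIR (SimpleGraph.pathGraph n) α {y, z} {z} := by
  obtain ⟨x, hx⟩ : ∃ x : Fin n, (x : ℕ) = p := ⟨⟨p, by omega⟩, rfl⟩
  obtain ⟨y, hy⟩ : ∃ y : Fin n, (y : ℕ) = p + k := ⟨⟨p + k, by omega⟩, rfl⟩
  obtain ⟨z, hz⟩ : ∃ z : Fin n, (z : ℕ) = p + 2 * k := ⟨⟨p + 2 * k, by omega⟩, rfl⟩
  have hxy : x ≠ y := fun h => by rw [h] at hx; omega
  have hxz : x ≠ z := fun h => by rw [h] at hx; omega
  have hyz : y ≠ z := fun h => by rw [h] at hy; omega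
  have hH := four_mul_sum_range_two_mul_sub k
  have hH2 := four_mul_sum_range_two_mul_sub (2 * k)
  have hH' := sq_add_le_four_mul_sum_range_sub_two_mul k
  have syz := sum_min_two_mul_sub (p + k) k (m + 1)
  have sxz := sum_min_two_mul_sub p (2 * k) (m + 1)
  have sxy := sum_min_two_mul_sub p k (k + (m + 1))
  have syx := sum_min_sub_two_mul p k (k + (m + 1))
  rw [show p + k + k + (m + 1) = n by omega] at syz
  rw [hn] at sxz
  rw [show p + k + (k + (m + 1)) = n by omega] at sxy syx
  set H := ∑ t ∈ range k, (2 * t - k)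
  set H2 := ∑ t ∈ range (2 * k), (2 * t - 2 * k)
  set H' := ∑ t ∈ range k, (k - 2 * t)
  have hHu : 4 * (H : ℝ) + 2 * k ≤ k ^ 2 + 1 := by exact_mod_cast hH.2
  have hHl : (k : ℝ) ^ 2 ≤ 4 * H + 2 * k := by exact_mod_cast hH.1
  have hH2l : (2 * k : ℝ) ^ 2 ≤ 4 * H2 + 2 * (2 * k) := by exact_mod_cast hH2.1
  have hH'l : (k : ℝ) ^ 2 + 2 * k ≤ 4 * H' := by exact_mod_cast hH'
  have hpr : (p : ℝ) = 2 * k - m - 1 := by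
    have : (p : ℝ) + (m + 1) = 2 * k := by exact_mod_cast hp
    linarith
  have hk1 : (1 : ℝ) ≤ k := by exact_mod_cast hk
  refine ⟨x, y, z, ?_, ?_, ?_, ?_⟩
  · refine SumIR.of_open
      (g := fun u => min (2 * (u : ℕ) - (p + (p + 2 * k))) (2 * k)) (by simp) (by simpa) (fun u => ?_) ?_
    · simp only [comDist, gwDist_singleton, pathGraph_dist, hx, hz]
      exact path_saving_of_single p (2 * k) u
    · rw [Fin.sum_univ_eq_sum_range (fun i => min (2 * i - (p + (p + 2 * k))) (2 * k)), sxz]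
      push_cast
      nlinarith
  · rw [Finset.insert_comm x y]
    refine SumIR.of_open
      (g := fun u => min (2 * (u : ℕ) - (p + k + (p + k + k))) k +
        min ((p + (p + k)) - 2 * (u : ℕ)) k)
      (by simp) (by simp [hxy.symm, hyz]) (fun u => ?_) ?_
    · simp only [comDist, gwDist_insert, gwDist_singleton, Finset.singleton_nonempty,
        pathGraph_dist, hx, hy, hz]
      exact path_saving_of_middle p k u
    · rw [Fin.sum_univ_eq_sum_range
        (fun i => min (2 * i - (p + k + (p + k + k))) k + min ((p + (p + k)) - 2 * i) k),
        Finset.sum_add_distrib, syz, syx]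
      push_cast
      rw [hpr]
      nlinarith
  · refine SumIR.of_close (g := fun u => min (2 * (u : ℕ) - (p + (p + k))) k) (by simp)
      (by simp [hxy, hxz]) (fun u => ?_) ?_
    · simp only [comDist, gwDist_insert, gwDist_singleton, Finset.singleton_nonempty,
        pathGraph_dist, hx, hy, hz]
      exact path_saving_of_far p k u
    · rw [Fin.sum_univ_eq_sum_range (fun i => min (2 * i - (p + (p + k))) k), sxy]
      push_cast
      nlinarith
  · refine SumIR.of_close (g := fun u => min (2 * (u : ℕ) - (p + k + (p + k + k))) k) (by simp)
      (by simpa) (fun u => ?_) ?_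
    · simp only [comDist, gwDist_singleton, pathGraph_dist, hy, hz]
      rw [show p + 2 * k = p + k + k by omega]
      exact path_saving_of_single (p + k) k u
    · rw [Fin.sum_univ_eq_sum_range (fun i => min (2 * i - (p + k + (p + k + k))) k), syz]
      push_cast
      nlinarith

/-- A relation that runs around a cycle of length four admits an infinite sequence. -/
theorem exists_seq_of_four_cycle {β : Type*} {r : β → β → Prop} {a b c d : β}
    (hab : r a b) (hbc : r b c) (hcd : r c d) (hda : r d a) :
    ∃ s : ℕ → β, s 0 = a ∧ ∀ i, r (s i) (s (i + 1)) := by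
  refine ⟨fun i => ![a, b, c, d] (Fin.ofNat 4 i), rfl, fun i => ?_⟩
  have h : Fin.ofNat 4 (i + 1) = Fin.ofNat 4 i + 1 := by
    ext
    simp [Fin.val_add]
  simp only [h]
  generalize Fin.ofNat 4 i = j
  fin_cases j
  exacts [hab, hbc, hcd, hda]

/-- For every n > 16 divisible by 4 and (3/32)n² + n < α < (5/32)n² there is a connected
graph on n vertices and an infinite improving-response sequence of the SUM-game. -/
theorem stmt_8 (n : ℕ) (hn : 16 < n) (h4 : 4 ∣ n) (α : ℝ)
    (hlo : (3 / 32 : ℝ) * (n : ℝ) ^ 2 + (n : ℝ) < α)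
    (hhi : α < (5 / 32 : ℝ) * (n : ℝ) ^ 2) :
    ∃ G : SimpleGraph (Fin n), G.Connected ∧
      ∃ seq : ℕ → Finset (Fin n), (seq 0).Nonempty ∧
        ∀ i, SumIR G α (seq i) (seq (i + 1)) := by
  obtain ⟨k, rfl⟩ := h4
  push_cast at hlo hhi
  have hk : 0 < k := by omega
  have hhi' : α < (5 / 2 : ℝ) * k ^ 2 := by linarith
  obtain ⟨m, hm, hopen, hclose⟩ := exists_tail_length hk (by linarith) hhi'
  obtain ⟨x, y, z, h1, h2, h3, h4⟩ :=
    pathGraph_improving_cycle (p := 2 * k - (m + 1)) (n := 4 * k) hk (by omega) (by omega) hhi'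
      hopen hclose
  obtain ⟨s, hs0, hs⟩ := exists_seq_of_four_cycle h1 h2 h3 h4
  have : Nonempty (Fin (4 * k)) := ⟨x⟩
  exact ⟨SimpleGraph.pathGraph (4 * k), ⟨SimpleGraph.pathGraph_preconnected _⟩, s,
    hs0 ▸ Finset.singleton_nonempty z, hs⟩
end

section
/- The SUM-game is not weakly acyclic: for α = 7, consider the graph G on 11 vertices consisting of three path vertices u, v, w with edges u−v and v−w, a 4-clique X, a 3-clique Y, and a center vertex c, where every vertex of X is adjacent to both c and u, every vertex of Y is adjacent to both c and w, and c is adjacent to v. Starting from the initial profile S = {w}, no finite sequence of improving responses of the SUM-game on G ends in a Nash equilibrium. -/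
open Finset

/-- The 4-clique X of the counterexample graph. -/
def cliqueX : Finset (Fin 11) := {4, 5, 6, 7}

/-- The 3-clique Y of the counterexample graph. -/
def cliqueY : Finset (Fin 11) := {8, 9, 10}

/-- The graph on 11 vertices: path u = 0, v = 1, w = 2, center c = 3, a 4-clique X whose
vertices are adjacent to c and u, and a 3-clique Y whose vertices are adjacent to c and w;
c is adjacent to v. -/
def nonWagGraph : SimpleGraph (Fin 11) :=
  SimpleGraph.fromRel (fun a b =>
    (a = 0 ∧ b = 1) ∨ (a = 1 ∧ b = 2) ∨ (a = 3 ∧ b = 1) ∨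
    (a ∈ cliqueX ∧ b ∈ cliqueX) ∨ (a ∈ cliqueY ∧ b ∈ cliqueY) ∨
    (a ∈ cliqueX ∧ (b = 3 ∨ b = 0)) ∨ (a ∈ cliqueY ∧ (b = 3 ∨ b = 2)))

instance : DecidableRel nonWagGraph.Adj :=
  fun a b => decidable_of_iff _ (SimpleGraph.fromRel_adj _ a b).symm

/-- A natural-valued function that satisfies the recursion of the distance from `a` is it. -/
theorem SimpleGraph.dist_eq_of_step {V : Type*} {G : SimpleGraph V} {f : V → V → ℕ}
    (hself : ∀ a, f a a = 0) (hlip : ∀ a b c, G.Adj b c → f a b ≤ f a c + 1)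
    (hpred : ∀ a b, a ≠ b → ∃ c, G.Adj c b ∧ f a b = f a c + 1) (a b : V) :
    G.dist a b = f a b := by
  have upper : ∀ n b, f a b = n → ∃ p : G.Walk a b, p.length = n := by
    intro n
    induction n with
    | zero =>
      intro b hb
      by_cases hab : a = b
      · subst hab
        exact ⟨.nil, rfl⟩
      · obtain ⟨c, -, hc⟩ := hpred a b hab
        omega
    | succ n ih =>
      intro b hb
      have hab : a ≠ b := by
        rintro rfl
        simp [hself] at hb
      obtain ⟨c, hcb, hc⟩ := hpred a b hab
      obtain ⟨p, hp⟩ := ih c (by omega)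
      exact ⟨p.concat hcb, by simp [hp]⟩
  have lower : ∀ {x y : V} (p : G.Walk x y), f a y ≤ f a x + p.length := by
    intro x y p
    induction p with
    | nil => simp
    | cons h p ih =>
      have h1 := hlip a _ _ h.symm
      rw [SimpleGraph.Walk.length_cons]
      omega
  obtain ⟨p, hp⟩ := upper _ b rfl
  obtain ⟨q, hq⟩ := p.reachable.exists_walk_length_eq_dist
  apply le_antisymm
  · exact hp ▸ SimpleGraph.dist_le p
  · have := lower q
    rw [hself] at this
    omega

/-- The hop distance of `nonWagGraph`, in computable form. -/
def hopDist (a b : Fin 11) : ℕ :=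
  if a = b then 0 else if nonWagGraph.Adj a b then 1
  else if ∃ c, nonWagGraph.Adj a c ∧ nonWagGraph.Adj c b then 2 else 3

theorem nonWagGraph_dist (a b : Fin 11) : nonWagGraph.dist a b = hopDist a b :=
  SimpleGraph.dist_eq_of_step (by decide +kernel) (by decide +kernel) (by decide +kernel) a b

/-- The distance to a nonempty gateway set in `nonWagGraph`, in computable form. -/
def hopDistSet (S : Finset (Fin 11)) (u : Fin 11) : ℕ :=
  S.fold min 3 (hopDist u)

theorem gwDist_nonWagGraph {S : Finset (Fin 11)} (hS : S.Nonempty) (u : Fin 11) :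
    gwDist nonWagGraph S u = hopDistSet S u := by
  have hne : ((fun s => nonWagGraph.dist u s) '' (S : Set (Fin 11))).Nonempty :=
    hS.to_set.image _
  have hmax : ∀ s, hopDist u s ≤ 3 := fun s => by
    unfold hopDist
    split_ifs <;> omega
  unfold gwDist hopDistSet
  simp only [nonWagGraph_dist] at hne ⊢
  apply le_antisymm
  · rw [Finset.le_fold_min]
    refine ⟨?_, fun s hs => Nat.sInf_le ⟨s, hs, rfl⟩⟩
    obtain ⟨s, hs⟩ := hS
    exact le_trans (Nat.sInf_le (Set.mem_image_of_mem _ hs)) (hmax s)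
  · obtain ⟨s, hs, h⟩ := Nat.sInf_mem hne
    rw [← h, Finset.fold_min_le]
    exact Or.inr ⟨s, hs, le_rfl⟩

/-- The private cost in `nonWagGraph` for `α = 7` as a natural number. -/
def natCost (S : Finset (Fin 11)) (v : Fin 11) : ℕ :=
  (if v ∈ S then 7 else 0) + ∑ u, min (hopDist v u) (hopDistSet S v + hopDistSet S u)

theorem sumCost_nonWagGraph {S : Finset (Fin 11)} (hS : S.Nonempty) (v : Fin 11) :
    sumCost nonWagGraph 7 S v = natCost S v := by
  simp only [sumCost, comDist, natCost, gwDist_nonWagGraph hS, nonWagGraph_dist]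
  push_cast
  rfl

/-- The profile in which `v` has switched its strategy. -/
def toggle (S : Finset (Fin 11)) (v : Fin 11) : Finset (Fin 11) :=
  if v ∈ S then S.erase v else insert v S

theorem sumIRBy_nonWagGraph_iff {S S' : Finset (Fin 11)} (hS : S.Nonempty) (v : Fin 11) :
    SumIRBy nonWagGraph 7 v S S' ↔
      S' = toggle S v ∧ (toggle S v).Nonempty ∧ natCost (toggle S v) v < natCost S v := by
  have key : ((v ∉ S ∧ S' = insert v S) ∨ (v ∈ S ∧ S' = S.erase v ∧ (S.erase v).Nonempty)) ↔
      S' = toggle S v ∧ (toggle S v).Nonempty := by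
    by_cases hv : v ∈ S <;> simp [toggle, hv]
  rw [SumIRBy, key, and_assoc]
  refine and_congr_right fun h => and_congr_right fun hne => ?_
  rw [h, sumCost_nonWagGraph hS, sumCost_nonWagGraph hne, Nat.cast_lt]

/-- The profiles `{w}`, `{u, w}`, `{u, v, w}`, `{v, w}`, which improving responses cycle through. -/
def responseCycle : Finset (Finset (Fin 11)) := {{2}, {0, 2}, {0, 1, 2}, {1, 2}}

theorem nonempty_of_mem_responseCycle {S : Finset (Fin 11)} (hS : S ∈ responseCycle) :
    S.Nonempty := by
  revert S
  decide +kernel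

theorem responseCycle_closed {S S' : Finset (Fin 11)} (hS : S ∈ responseCycle)
    (h : SumIR nonWagGraph 7 S S') : S' ∈ responseCycle := by
  have key : ∀ S ∈ responseCycle, ∀ v, natCost (toggle S v) v < natCost S v →
      (toggle S v).Nonempty → toggle S v ∈ responseCycle := by
    decide +kernel
  obtain ⟨v, hv⟩ := h
  obtain ⟨rfl, hne, hlt⟩ := (sumIRBy_nonWagGraph_iff (nonempty_of_mem_responseCycle hS) v).1 hv
  exact key S hS v hlt hne

theorem not_sumNash_of_mem_responseCycle {S : Finset (Fin 11)} (hS : S ∈ responseCycle) :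
    ¬ SumNash nonWagGraph 7 S := by
  have key : ∀ S ∈ responseCycle, ∃ v,
      (toggle S v).Nonempty ∧ natCost (toggle S v) v < natCost S v := by
    decide +kernel
  obtain ⟨v, hv⟩ := key S hS
  exact fun hN =>
    hN _ ⟨v, (sumIRBy_nonWagGraph_iff (nonempty_of_mem_responseCycle hS) v).2 ⟨rfl, hv⟩⟩

/-- The SUM-game is not weakly acyclic: on this graph with α = 7, no finite sequence of
improving responses starting from S = {w} ends in a Nash equilibrium. -/
theorem stmt_9 :
    ¬ ∃ (k : ℕ) (seq : ℕ → Finset (Fin 11)), seq 0 = {2} ∧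
        (∀ i < k, SumIR nonWagGraph 7 (seq i) (seq (i + 1))) ∧
        SumNash nonWagGraph 7 (seq k) := by
  rintro ⟨k, seq, h0, hstep, hN⟩
  have hmem : ∀ i ≤ k, seq i ∈ responseCycle := by
    intro i
    induction i with
    | zero => simp [h0, responseCycle]
    | succ i ih => exact fun hi => responseCycle_closed (ih (by omega)) (hstep i (by omega))
  exact not_sumNash_of_mem_responseCycle (hmem k le_rfl) hN
end
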